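/- arXiv:2009.09834 — 3 statements merged into one kernel-verified Lean document; each statement's English description precedes it below -/
import Mathlib

section
/- Let (Ω, 𝓕) be a measurable space and let L : ℝ^n × ℝ^n × ℝ × Ω → ℝ be such that for each ω ∈ Ω the function L(·,·,·,ω) is continuous and bounded below, and for each (x,v,t) ∈ ℝ^n × ℝ^n × ℝ the function L(x,v,t,·) is 𝓕-measurable. For ω ∈ Ω let A^ω denote the Lagrangian action associated to L(·,·,·,ω). Then for all s < t and all x, y ∈ ℝ^n, the map ω ↦ A^ω(s,y;t,x) is 𝓕-measurable. -/
noncomputable section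

/-- `γ : ℝ → ℝⁿ` is an admissible (Lipschitz) curve from `(s,y)` to `(t,x)`. -/
def IsCurve {n : ℕ} (s t : ℝ) (y x : EuclideanSpace ℝ (Fin n))
    (γ : ℝ → EuclideanSpace ℝ (Fin n)) : Prop :=
  (∃ K : NNReal, LipschitzOnWith K γ (Set.Icc s t)) ∧ γ s = y ∧ γ t = x

/-- The action of `L` along the curve `γ` on `[s,t]`. -/
def curveAction {n : ℕ}
    (L : EuclideanSpace ℝ (Fin n) → EuclideanSpace ℝ (Fin n) → ℝ → ℝ)
    (s t : ℝ) (γ : ℝ → EuclideanSpace ℝ (Fin n)) : ℝ :=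
  ∫ σ in s..t, L (γ σ) (deriv γ σ) σ

/-- The Lagrangian action `A(s,y;t,x)`. -/
def action {n : ℕ}
    (L : EuclideanSpace ℝ (Fin n) → EuclideanSpace ℝ (Fin n) → ℝ → ℝ)
    (s t : ℝ) (y x : EuclideanSpace ℝ (Fin n)) : ℝ :=
  sInf {a | ∃ γ : ℝ → EuclideanSpace ℝ (Fin n), IsCurve s t y x γ ∧ a = curveAction L s t γ}

open MeasureTheory Filter Topology Set

/-- The phase-space curve `σ ↦ (γ σ, γ' σ)` of `γ`, with the position frozen outside `[s,t]`. -/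
def phaseCurve {n : ℕ} {s t : ℝ} (hst : s ≤ t) (γ : ℝ → EuclideanSpace ℝ (Fin n)) (σ : ℝ) :
    EuclideanSpace ℝ (Fin n) × EuclideanSpace ℝ (Fin n) :=
  (γ (projIcc s t hst σ), deriv γ σ)

theorem measurable_phaseCurve {n : ℕ} {s t : ℝ} (hst : s ≤ t)
    {γ : ℝ → EuclideanSpace ℝ (Fin n)} (hγ : ContinuousOn γ (Icc s t)) :
    Measurable (phaseCurve hst γ) := by
  have h : Continuous fun σ => γ (projIcc s t hst σ) :=
    hγ.comp_continuous (continuous_subtype_val.comp continuous_projIcc) fun σ => Subtype.prop _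
  exact h.measurable.prodMk (measurable_deriv γ)

theorem curveAction_eq_integral_phaseCurve {n : ℕ}
    (L : EuclideanSpace ℝ (Fin n) → EuclideanSpace ℝ (Fin n) → ℝ → ℝ)
    {s t : ℝ} (hst : s ≤ t) (γ : ℝ → EuclideanSpace ℝ (Fin n)) :
    curveAction L s t γ =
      ∫ σ in Ioc s t, L (phaseCurve hst γ σ).1 (phaseCurve hst γ σ).2 σ := by
  rw [curveAction, intervalIntegral.integral_of_le hst]
  refine setIntegral_congr_fun measurableSet_Ioc fun σ hσ => ?_
  simp only [phaseCurve, projIcc_of_mem hst (Ioc_subset_Icc_self hσ)]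

/-- A `K`-Lipschitz curve starting at `y` has its phase-space curve in a fixed compact set. -/
theorem phaseCurve_mem_closedBall {n : ℕ} {s t : ℝ} (hst : s ≤ t)
    {γ : ℝ → EuclideanSpace ℝ (Fin n)} {K : NNReal} (hγ : LipschitzOnWith K γ (Icc s t)) :
    ∀ᵐ σ ∂volume.restrict (Ioc s t), phaseCurve hst γ σ ∈
      Metric.closedBall (γ s) (K * (t - s)) ×ˢ Metric.closedBall 0 (K : ℝ) := by
  rw [← restrict_Ioo_eq_restrict_Ioc]
  filter_upwards [ae_restrict_mem measurableSet_Ioo] with σ hσ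
  constructor
  · have hp := (projIcc s t hst σ).2
    rw [Metric.mem_closedBall]
    refine (hγ.dist_le_mul _ hp _ (left_mem_Icc.2 hst)).trans ?_
    gcongr
    rw [Real.dist_eq, abs_of_nonneg (by linarith [hp.1])]
    linarith [hp.2]
  · rw [mem_closedBall_zero_iff]
    exact norm_deriv_le_of_lipschitzOn (Icc_mem_nhds hσ.1 hσ.2) hγ

theorem memLp_phaseCurve {n : ℕ} {s t : ℝ} (hst : s ≤ t)
    {γ : ℝ → EuclideanSpace ℝ (Fin n)} {K : NNReal} (hγ : LipschitzOnWith K γ (Icc s t)) :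
    MemLp (phaseCurve hst γ) 1 (volume.restrict (Ioc s t)) := by
  obtain ⟨C, hC⟩ := ((isCompact_closedBall (γ s) (K * (t - s))).prod
    (isCompact_closedBall (0 : EuclideanSpace ℝ (Fin n)) (K : ℝ))).isBounded.exists_norm_le
  exact MemLp.of_bound (measurable_phaseCurve hst hγ.continuousOn).aestronglyMeasurable C
    ((phaseCurve_mem_closedBall hst hγ).mono fun σ hσ => hC _ hσ)

/-- Dominated convergence for the action along uniformly Lipschitz curves. -/
theorem tendsto_curveAction {n : ℕ}
    {L : EuclideanSpace ℝ (Fin n) → EuclideanSpace ℝ (Fin n) → ℝ → ℝ}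
    (hL : Continuous
      (fun q : EuclideanSpace ℝ (Fin n) × EuclideanSpace ℝ (Fin n) × ℝ => L q.1 q.2.1 q.2.2))
    {s t : ℝ} (hst : s ≤ t) {y : EuclideanSpace ℝ (Fin n)} {K : NNReal}
    {γ : ℝ → EuclideanSpace ℝ (Fin n)} {η : ℕ → ℝ → EuclideanSpace ℝ (Fin n)}
    (hη : ∀ k, LipschitzOnWith K (η k) (Icc s t)) (hηs : ∀ k, η k s = y)
    (hlim : ∀ᵐ σ ∂volume.restrict (Ioc s t),
      Tendsto (fun k => phaseCurve hst (η k) σ) atTop (𝓝 (phaseCurve hst γ σ))) :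
    Tendsto (fun k => curveAction L s t (η k)) atTop (𝓝 (curveAction L s t γ)) := by
  simp only [curveAction_eq_integral_phaseCurve L hst]
  obtain ⟨C, hC⟩ := ((isCompact_closedBall y (K * (t - s))).prod
    ((isCompact_closedBall (0 : EuclideanSpace ℝ (Fin n)) (K : ℝ)).prod
      (isCompact_Icc (a := s) (b := t)))).exists_bound_of_continuousOn hL.continuousOn
  refine tendsto_integral_of_dominated_convergence (fun _ => C) (fun k => ?_)
    (integrable_const C) (fun k => ?_) ?_
  · have hm := measurable_phaseCurve hst (hη k).continuousOn
    exact (hL.measurable.comp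
      (hm.fst.prodMk (hm.snd.prodMk measurable_id))).aestronglyMeasurable
  · filter_upwards [phaseCurve_mem_closedBall hst (hη k), ae_restrict_mem measurableSet_Ioc]
      with σ hσ hσ'
    rw [hηs k] at hσ
    exact hC (_, _, σ) ⟨hσ.1, hσ.2, Ioc_subset_Icc_self hσ'⟩
  · filter_upwards [hlim] with σ hσ
    exact (hL.tendsto (_, _, σ)).comp
      (hσ.fst_nhds.prodMk_nhds (hσ.snd_nhds.prodMk_nhds tendsto_const_nhds))

/-- Among the `K`-Lipschitz curves with fixed endpoints, countably many suffice to approximate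
the action of every other one, for all continuous Lagrangians at once. -/
theorem exists_countable_curveAction_mem_closure {n : ℕ} {s t : ℝ} (hst : s ≤ t)
    (y x : EuclideanSpace ℝ (Fin n)) (K : NNReal) :
    ∃ D : Set (ℝ → EuclideanSpace ℝ (Fin n)), D.Countable ∧ (∀ γ ∈ D, IsCurve s t y x γ) ∧
      ∀ L : EuclideanSpace ℝ (Fin n) → EuclideanSpace ℝ (Fin n) → ℝ → ℝ,
        Continuous (fun q : EuclideanSpace ℝ (Fin n) × EuclideanSpace ℝ (Fin n) × ℝ =>
          L q.1 q.2.1 q.2.2) →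
        ∀ γ, LipschitzOnWith K γ (Icc s t) → γ s = y → γ t = x →
          curveAction L s t γ ∈ closure (curveAction L s t '' D) := by
  let C := {γ : ℝ → EuclideanSpace ℝ (Fin n) // LipschitzOnWith K γ (Icc s t) ∧ γ s = y ∧ γ t = x}
  let Φ : C → Lp (EuclideanSpace ℝ (Fin n) × EuclideanSpace ℝ (Fin n)) 1
      (volume.restrict (Ioc s t)) := fun γ => (memLp_phaseCurve hst γ.2.1).toLp
  have : Fact ((1 : ENNReal) ≠ ⊤) := ⟨ENNReal.one_ne_top⟩
  obtain ⟨T, hTsub, hTc, hTd⟩ := (TopologicalSpace.IsSeparable.of_separableSpace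
    (range Φ)).exists_countable_dense_subset
  obtain ⟨D, hDc, hDT⟩ : ∃ D : Set C, D.Countable ∧ Φ '' D = T := by
    obtain ⟨D, hD, hinj⟩ := exists_subset_bijOn (Φ ⁻¹' T) Φ
    rw [image_preimage_eq_of_subset hTsub] at hinj
    exact ⟨D, hinj.mapsTo.countable_of_injOn hinj.injOn hTc, hinj.image_eq⟩
  refine ⟨Subtype.val '' D, hDc.image _, ?_, fun L hL γ hγ hγs hγt => ?_⟩
  · rintro _ ⟨γ, -, rfl⟩
    exact ⟨⟨K, γ.2.1⟩, γ.2.2⟩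
  · obtain ⟨f, hfT, hf⟩ := mem_closure_iff_seq_limit.1
      (hTd (mem_range_self (⟨γ, hγ, hγs, hγt⟩ : C)))
    have hex : ∀ k, ∃ η ∈ D, Φ η = f k := fun k => by simpa [← hDT] using hfT k
    choose η hηD hη using hex
    obtain ⟨ns, -, hns⟩ := (tendstoInMeasure_of_tendsto_Lp hf).exists_seq_tendsto_ae
    refine mem_closure_of_tendsto (tendsto_curveAction hL hst
      (η := fun k => (η (ns k)).1) (fun k => (η (ns k)).2.1) (fun k => (η (ns k)).2.2.1) ?_)
      (Eventually.of_forall fun k => mem_image_of_mem _ (mem_image_of_mem _ (hηD (ns k))))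
    have hcoe : ∀ᵐ σ ∂volume.restrict (Ioc s t),
        ∀ k, f (ns k) σ = phaseCurve hst (η (ns k)).1 σ :=
      ae_all_iff.2 fun k => by
        rw [← hη]
        exact (memLp_phaseCurve hst (η (ns k)).2.1).coeFn_toLp
    filter_upwards [hns, hcoe, (memLp_phaseCurve hst hγ).coeFn_toLp] with σ h₁ h₂ h₃
    simp only [h₂] at h₁
    rwa [← h₃]

theorem measurable_curveAction {n : ℕ} {Ω : Type*} [MeasurableSpace Ω]
    {L : EuclideanSpace ℝ (Fin n) → EuclideanSpace ℝ (Fin n) → ℝ → Ω → ℝ}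
    (hcont : ∀ ω : Ω, Continuous
      (fun q : EuclideanSpace ℝ (Fin n) × EuclideanSpace ℝ (Fin n) × ℝ => L q.1 q.2.1 q.2.2 ω))
    (hmeas : ∀ (x v : EuclideanSpace ℝ (Fin n)) (t : ℝ), Measurable (fun ω => L x v t ω))
    {s t : ℝ} (hst : s ≤ t) {γ : ℝ → EuclideanSpace ℝ (Fin n)} (hγ : ContinuousOn γ (Icc s t)) :
    Measurable fun ω => curveAction (fun a b c => L a b c ω) s t γ := by
  simp only [fun ω => curveAction_eq_integral_phaseCurve (fun a b c => L a b c ω) hst γ]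
  have hm := measurable_phaseCurve hst hγ
  have hL := measurable_uncurry_of_continuous_of_measurable
    (u := fun (q : EuclideanSpace ℝ (Fin n) × EuclideanSpace ℝ (Fin n) × ℝ) ω =>
      L q.1 q.2.1 q.2.2 ω) hcont (fun q => hmeas q.1 q.2.1 q.2.2)
  have hΨ : Measurable fun p : Ω × ℝ =>
      (((phaseCurve hst γ p.2).1, (phaseCurve hst γ p.2).2, p.2), p.1) :=
    (((hm.fst.prodMk (hm.snd.prodMk measurable_id)).comp measurable_snd).prodMk measurable_fst)
  exact (StronglyMeasurable.integral_prod_right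
    (f := fun ω σ => L (phaseCurve hst γ σ).1 (phaseCurve hst γ σ).2 σ ω)
    (hL.comp hΨ).stronglyMeasurable).measurable

theorem exists_isCurve {n : ℕ} {s t : ℝ} (hst : s < t) (y x : EuclideanSpace ℝ (Fin n)) :
    ∃ γ, IsCurve s t y x γ := by
  have hl : LipschitzWith (‖(t - s)⁻¹ • (x - y)‖₊)
      fun σ : ℝ => y + (σ - s) • ((t - s)⁻¹ • (x - y)) := by
    refine LipschitzWith.of_dist_le_mul fun a b => le_of_eq ?_
    rw [dist_add_left, dist_eq_norm, ← sub_smul, norm_smul, Real.dist_eq, coe_nnnorm,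
      sub_sub_sub_cancel_right, Real.norm_eq_abs, mul_comm]
  refine ⟨_, ⟨_, hl.lipschitzOnWith⟩, by simp, ?_⟩
  simp [smul_smul, mul_inv_cancel₀ (sub_ne_zero.2 hst.ne')]

theorem le_curveAction {n : ℕ}
    {L : EuclideanSpace ℝ (Fin n) → EuclideanSpace ℝ (Fin n) → ℝ → ℝ} {m : ℝ}
    (hm : ∀ x v t, m ≤ L x v t) {s t : ℝ} (hst : s ≤ t) (γ : ℝ → EuclideanSpace ℝ (Fin n)) :
    min 0 (m * (t - s)) ≤ curveAction L s t γ := by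
  by_cases h : IntervalIntegrable (fun σ => L (γ σ) (deriv γ σ) σ) volume s t
  · refine (min_le_right _ _).trans ?_
    calc m * (t - s) = ∫ _ in s..t, m := by simp [mul_comm]
      _ ≤ _ := intervalIntegral.integral_mono_on hst intervalIntegrable_const h
        fun σ _ => hm _ _ _
  · rw [curveAction, intervalIntegral.integral_undef h]
    exact min_le_left _ _

/-- If `L(·,·,·,ω)` is continuous and bounded below for each `ω`, and `L(x,v,t,·)` is
measurable for each `(x,v,t)`, then `ω ↦ A^ω(s,y;t,x)` is measurable. -/
theorem stmt_9 (n : ℕ) {Ω : Type*} [MeasurableSpace Ω]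
    (L : EuclideanSpace ℝ (Fin n) → EuclideanSpace ℝ (Fin n) → ℝ → Ω → ℝ)
    (hcont : ∀ ω : Ω, Continuous
      (fun q : EuclideanSpace ℝ (Fin n) × EuclideanSpace ℝ (Fin n) × ℝ => L q.1 q.2.1 q.2.2 ω))
    (hbdd : ∀ ω : Ω, ∃ m : ℝ, ∀ (x v : EuclideanSpace ℝ (Fin n)) (t : ℝ), m ≤ L x v t ω)
    (hmeas : ∀ (x v : EuclideanSpace ℝ (Fin n)) (t : ℝ), Measurable (fun ω => L x v t ω))
    (s t : ℝ) (hst : s < t) (y x : EuclideanSpace ℝ (Fin n)) :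
    Measurable (fun ω => action (fun a b c => L a b c ω) s t y x) := by
  choose D hDc hDcurve hDdense using
    fun N : ℕ => exists_countable_curveAction_mem_closure hst.le y x (N : NNReal)
  have hUc : (⋃ N, D N).Countable := countable_iUnion hDc
  have hUcurve : ∀ γ ∈ ⋃ N, D N, IsCurve s t y x γ := fun γ hγ => by
    obtain ⟨N, hN⟩ := mem_iUnion.1 hγ
    exact hDcurve N γ hN
  have heq : ∀ ω, action (fun a b c => L a b c ω) s t y x =
      ⨅ γ : ⋃ N, D N, curveAction (fun a b c => L a b c ω) s t γ := fun ω => by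
    set A := curveAction (fun a b c => L a b c ω) s t
    set S := {a | ∃ γ : ℝ → EuclideanSpace ℝ (Fin n), IsCurve s t y x γ ∧ a = A γ}
    have hsub : A '' (⋃ N, D N) ⊆ S := by
      rintro _ ⟨γ, hγ, rfl⟩
      exact ⟨γ, hUcurve γ hγ, rfl⟩
    have hcl : S ⊆ closure (A '' (⋃ N, D N)) := by
      rintro _ ⟨γ, ⟨⟨K, hK⟩, hs, ht⟩, rfl⟩
      obtain ⟨N, hN⟩ := exists_nat_ge K
      exact closure_mono (image_mono (subset_iUnion D N))
        (hDdense N _ (hcont ω) γ (hK.weaken hN) hs ht)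
    obtain ⟨m, hm⟩ := hbdd ω
    have hbelow : BddBelow S := ⟨min 0 (m * (t - s)), by
      rintro _ ⟨γ, -, rfl⟩
      exact le_curveAction (L := fun a b c => L a b c ω) hm hst.le γ⟩
    obtain ⟨γ₀, hγ₀⟩ := exists_isCurve hst y x
    have hne : S.Nonempty := ⟨_, γ₀, hγ₀, rfl⟩
    have hneU : (A '' (⋃ N, D N)).Nonempty := closure_nonempty_iff.1 (hne.mono hcl)
    rw [iInf, ← image_eq_range]
    refine le_antisymm (csInf_le_csInf hbelow hneU hsub) (le_csInf hne fun a ha => ?_)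
    have hlb : sInf (A '' (⋃ N, D N)) ∈ lowerBounds (closure (A '' (⋃ N, D N))) := by
      rw [lowerBounds_closure]
      exact fun b hb => csInf_le (hbelow.mono hsub) hb
    exact hlb (hcl ha)
  simp only [heq]
  have := hUc.to_subtype
  refine Measurable.iInf fun γ => ?_
  obtain ⟨K, hK⟩ := (hUcurve γ γ.2).1
  exact measurable_curveAction hcont hmeas hst.le hK.continuousOn
end
end

section
/- Let L : ℝ^n × ℝ^n × ℝ → ℝ be continuous and bounded below, let α ∈ ℝ, and let t₀ ∈ ℝ. Let u, u₊ : ℝ^n × ℝ → ℝ satisfy: (a) for all s < t and all x, y: u(x,t) ≤ u(y,s) + A(s,y;t,x) + (t−s)α and u₊(y,s) ≤ u₊(x,t) + A(s,y;t,x) + (t−s)α. Let γ : ℝ → ℝ^n be locally Lipschitz and suppose: (b) for all s < t ≤ t₀, u(γ(t),t) = u(γ(s),s) + ∫_s^t L(γ(σ),γ'(σ),σ)dσ + (t−s)α (γ is a calibrated curve of u on (−∞,t₀]); (c) for all t₀ ≤ t < s, u₊(γ(t),t) = u₊(γ(s),s) + ∫_t^s L(γ(σ),γ'(σ),σ)dσ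 + (s−t)α (γ is a calibrated curve of u₊ on [t₀,∞)); (d) u(γ(t₀),t₀) + u₊(γ(t₀),t₀) ≤ u(x,t₀) + u₊(x,t₀) for every x ∈ ℝ^n. Then γ is a global minimizer of the Lagrangian action: for all s < t, ∫_s^t L(γ(σ), γ'(σ), σ) dσ = A(s, γ(s); t, γ(t)). -/
noncomputable section

theorem intervalIntegrable_lagrangian_of_lipschitzOn {n : ℕ}
    {L : EuclideanSpace ℝ (Fin n) → EuclideanSpace ℝ (Fin n) → ℝ → ℝ}
    (hL : Continuous (fun q : EuclideanSpace ℝ (Fin n) × EuclideanSpace ℝ (Fin n) × ℝ =>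
      L q.1 q.2.1 q.2.2))
    {s t : ℝ} (hst : s ≤ t) {K : NNReal} {η : ℝ → EuclideanSpace ℝ (Fin n)}
    (hη : LipschitzOnWith K η (Set.Icc s t)) :
    IntervalIntegrable (fun σ => L (η σ) (deriv η σ) σ) MeasureTheory.volume s t := by
  rw [intervalIntegrable_iff_integrableOn_Ioo_of_le hst]
  have hmeas : MeasureTheory.AEStronglyMeasurable (fun σ => L (η σ) (deriv η σ) σ)
      (MeasureTheory.volume.restrict (Set.Ioo s t)) := by
    have hη' : MeasureTheory.AEStronglyMeasurable η
        (MeasureTheory.volume.restrict (Set.Ioo s t)) :=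
      (hη.continuousOn.mono Set.Ioo_subset_Icc_self).aestronglyMeasurable measurableSet_Ioo
    exact hL.comp_aestronglyMeasurable
      (hη'.prodMk ((aestronglyMeasurable_deriv η _).prodMk
        continuous_id.aestronglyMeasurable))
  obtain ⟨C, hC⟩ := (((isCompact_Icc (a := s) (b := t)).image_of_continuousOn
    hη.continuousOn).prod ((isCompact_closedBall (0 : EuclideanSpace ℝ (Fin n)) K).prod
      (isCompact_Icc (a := s) (b := t)))).exists_bound_of_continuousOn hL.continuousOn
  refine ⟨hmeas, .restrict_of_bounded (C := C) measure_Ioo_lt_top ?_⟩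
  filter_upwards [MeasureTheory.ae_restrict_mem measurableSet_Ioo] with σ hσ
  have hσ' := Set.Ioo_subset_Icc_self hσ
  exact hC (η σ, deriv η σ, σ) ⟨Set.mem_image_of_mem _ hσ', mem_closedBall_zero_iff.2
    (norm_deriv_le_of_lipschitzOn (Icc_mem_nhds hσ.1 hσ.2) hη), hσ'⟩

theorem action_le_curveAction {n : ℕ}
    {L : EuclideanSpace ℝ (Fin n) → EuclideanSpace ℝ (Fin n) → ℝ → ℝ}
    (hL : Continuous (fun q : EuclideanSpace ℝ (Fin n) × EuclideanSpace ℝ (Fin n) × ℝ =>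
      L q.1 q.2.1 q.2.2))
    (hbdd : ∃ m : ℝ, ∀ (x v : EuclideanSpace ℝ (Fin n)) (t : ℝ), m ≤ L x v t)
    {s t : ℝ} (hst : s ≤ t) {K : NNReal} {η : ℝ → EuclideanSpace ℝ (Fin n)}
    (hη : LipschitzOnWith K η (Set.Icc s t)) :
    action L s t (η s) (η t) ≤ curveAction L s t η := by
  obtain ⟨m, hm⟩ := hbdd
  refine csInf_le ⟨∫ _ in s..t, m, ?_⟩ ⟨η, ⟨⟨K, hη⟩, rfl, rfl⟩, rfl⟩
  rintro _ ⟨ξ, ⟨⟨K', hξ⟩, -, -⟩, rfl⟩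
  exact intervalIntegral.integral_mono_on hst intervalIntegrable_const
    (intervalIntegrable_lagrangian_of_lipschitzOn hL hst hξ) fun _ _ => hm _ _ _

theorem curveAction_add_adjacent {n : ℕ}
    {L : EuclideanSpace ℝ (Fin n) → EuclideanSpace ℝ (Fin n) → ℝ → ℝ}
    (hL : Continuous (fun q : EuclideanSpace ℝ (Fin n) × EuclideanSpace ℝ (Fin n) × ℝ =>
      L q.1 q.2.1 q.2.2))
    {r s t : ℝ} (hrs : r ≤ s) (hst : s ≤ t) {K : NNReal} {η : ℝ → EuclideanSpace ℝ (Fin n)}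
    (hη : LipschitzOnWith K η (Set.Icc r t)) :
    curveAction L r s η + curveAction L s t η = curveAction L r t η :=
  intervalIntegral.integral_add_adjacent_intervals
    (intervalIntegrable_lagrangian_of_lipschitzOn hL hrs
      (hη.mono (Set.Icc_subset_Icc_right hst)))
    (intervalIntegrable_lagrangian_of_lipschitzOn hL hst
      (hη.mono (Set.Icc_subset_Icc_left hrs)))

/-- A curve calibrated by a dominated function `u` in the past of `t₀`, calibrated by a
dominated function `u₊` in the future of `t₀`, and passing at time `t₀` through a minimum
point of `u(·,t₀) + u₊(·,t₀)`, is a global minimizer of the Lagrangian action. -/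
theorem stmt_12 (n : ℕ)
    (L : EuclideanSpace ℝ (Fin n) → EuclideanSpace ℝ (Fin n) → ℝ → ℝ)
    (hL : Continuous (fun q : EuclideanSpace ℝ (Fin n) × EuclideanSpace ℝ (Fin n) × ℝ =>
      L q.1 q.2.1 q.2.2))
    (hbdd : ∃ m : ℝ, ∀ (x v : EuclideanSpace ℝ (Fin n)) (t : ℝ), m ≤ L x v t)
    (α t₀ : ℝ) (u uP : EuclideanSpace ℝ (Fin n) → ℝ → ℝ)
    (hdomu : ∀ (s t : ℝ), s < t → ∀ x y : EuclideanSpace ℝ (Fin n),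
      u x t ≤ u y s + action L s t y x + (t - s) * α)
    (hdomuP : ∀ (s t : ℝ), s < t → ∀ x y : EuclideanSpace ℝ (Fin n),
      uP y s ≤ uP x t + action L s t y x + (t - s) * α)
    (γ : ℝ → EuclideanSpace ℝ (Fin n)) (hγ : LocallyLipschitz γ)
    (hcalu : ∀ s t : ℝ, s < t → t ≤ t₀ →
      u (γ t) t = u (γ s) s + (∫ σ in s..t, L (γ σ) (deriv γ σ) σ) + (t - s) * α)
    (hcaluP : ∀ t s : ℝ, t₀ ≤ t → t < s →
      uP (γ t) t = uP (γ s) s + (∫ σ in t..s, L (γ σ) (deriv γ σ) σ) + (s - t) * α)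
    (hmin : ∀ x : EuclideanSpace ℝ (Fin n),
      u (γ t₀) t₀ + uP (γ t₀) t₀ ≤ u x t₀ + uP x t₀) :
    ∀ s t : ℝ, s < t →
      (∫ σ in s..t, L (γ σ) (deriv γ σ) σ) = action L s t (γ s) (γ t) := by
  intro s t hst
  obtain ⟨K, hK⟩ := (hγ.locallyLipschitzOn (s := Set.Icc s t)).exists_lipschitzOnWith_of_compact
    isCompact_Icc
  refine le_antisymm ?_ (action_le_curveAction hL hbdd hst.le hK)
  rcases le_or_gt t t₀ with ht | ht
  · linarith [hcalu s t hst ht, hdomu s t hst (γ t) (γ s)]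
  rcases le_or_gt t₀ s with hs | hs
  · linarith [hcaluP s t hs hst, hdomuP s t hst (γ t) (γ s)]
  refine le_csInf ⟨_, γ, ⟨⟨K, hK⟩, rfl, rfl⟩, rfl⟩ ?_
  rintro _ ⟨η, ⟨⟨K', hη⟩, hηs, hηt⟩, rfl⟩
  have past := action_le_curveAction hL hbdd hs.le
    (hη.mono (Set.Icc_subset_Icc_right ht.le))
  have future := action_le_curveAction hL hbdd ht.le
    (hη.mono (Set.Icc_subset_Icc_left hs.le))
  rw [hηs] at past
  rw [hηt] at future
  have splitη := curveAction_add_adjacent hL hs.le ht.le hη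
  have splitγ := curveAction_add_adjacent hL hs.le ht.le hK
  have calu := hcalu s t₀ hs le_rfl
  have caluP := hcaluP t₀ t le_rfl ht
  change curveAction L s t γ ≤ _
  change _ = _ + curveAction L s t₀ γ + _ at calu
  change _ = _ + curveAction L t₀ t γ + _ at caluP
  linarith [hdomu s t₀ hs (η t₀) (γ s), hdomuP t₀ t ht (γ t) (η t₀), hmin (η t₀)]
end
end

section
/- Let U ⊆ ℝ^n be open and let f, g : U → ℝ be semiconcave. If the function f + g attains a local minimum at a point x₀ ∈ U, then both f and g are differentiable at x₀ and Df(x₀) + Dg(x₀) = 0. -/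
noncomputable section

/-- `u` is semiconcave on `U`. -/
def Semiconcave {n : ℕ} (U : Set (EuclideanSpace ℝ (Fin n)))
    (u : EuclideanSpace ℝ (Fin n) → ℝ) : Prop :=
  ∀ K : Set (EuclideanSpace ℝ (Fin n)), K ⊆ U → IsCompact K → Convex ℝ K →
    ∃ C : ℝ, 0 ≤ C ∧ ∀ t ∈ Set.Icc (0 : ℝ) 1, ∀ x₀ ∈ K, ∀ x₁ ∈ K,
      t * u x₁ + (1 - t) * u x₀ - u (t • x₁ + (1 - t) • x₀) ≤
        C * t * (1 - t) * ‖x₁ - x₀‖ ^ 2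

open Set Filter Topology Metric Asymptotics

/-- A convex function on an open convex set of a finite-dimensional space has a subgradient at
every point. -/
theorem ConvexOn.exists_subgradient {E : Type*} [NormedAddCommGroup E] [NormedSpace ℝ E]
    [FiniteDimensional ℝ E] {s : Set E} {φ : E → ℝ} (hs : IsOpen s) (hφ : ConvexOn ℝ s φ)
    {x : E} (hx : x ∈ s) :
    ∃ l : E →L[ℝ] ℝ, ∀ y ∈ s, φ x + l (y - x) ≤ φ y := by
  have hopen : IsOpen {p : E × ℝ | p.1 ∈ s ∧ φ p.1 < p.2} := by
    have hsub : ContinuousOn (fun p : E × ℝ => φ p.1 - p.2) (Prod.fst ⁻¹' s) :=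
      ((hφ.continuousOn hs).comp continuousOn_fst fun _ hp => hp).sub continuousOn_snd
    convert hsub.isOpen_inter_preimage (hs.preimage continuous_fst) (isOpen_Iio (a := 0)) using 1
    ext p
    simp
  obtain ⟨F, hF⟩ := geometric_hahn_banach_point_open (x := (x, φ x)) hφ.convex_strict_epigraph
    hopen (by simp)
  have hsplit (y : E) (r : ℝ) : F (y, r) = F (y, 0) + r * F (0, 1) := by
    rw [← smul_eq_mul, ← map_smul, ← map_add]
    simp
  have hpos : 0 < F (0, 1) := by
    have h := hF (x, φ x + 1) ⟨hx, by simp⟩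
    rw [hsplit x (φ x), hsplit x (φ x + 1)] at h
    linarith
  refine ⟨-(F (0, 1))⁻¹ • F.comp (.inl ℝ E ℝ), fun y hy => ?_⟩
  have hle : φ x * F (0, 1) - F (y - x, 0) ≤ φ y * F (0, 1) := by
    have hdiff : F (y - x, 0) = F (y, 0) - F (x, 0) := by
      rw [← map_sub]
      simp
    refine le_of_forall_pos_lt_add fun ε hε => ?_
    have h := hF (y, φ y + ε / F (0, 1)) ⟨hy, by simpa using div_pos hε hpos⟩
    rw [hsplit x, hsplit y, add_mul, div_mul_cancel₀ _ hpos.ne'] at h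
    linarith
  have hval : (-(F (0, 1))⁻¹ • F.comp (.inl ℝ E ℝ)) (y - x) = -(F (y - x, 0) / F (0, 1)) := by
    simp [div_eq_inv_mul]
  rw [hval, ← sub_eq_add_neg, ← mul_le_mul_iff_left₀ hpos, sub_mul, div_mul_cancel₀ _ hpos.ne']
  exact hle

theorem norm_sq_convexCombination {E : Type*} [NormedAddCommGroup E] [InnerProductSpace ℝ E]
    (t : ℝ) (x y : E) :
    ‖t • x + (1 - t) • y‖ ^ 2 =
      t * ‖x‖ ^ 2 + (1 - t) * ‖y‖ ^ 2 - t * (1 - t) * ‖x - y‖ ^ 2 := by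
  rw [norm_add_sq_real, norm_sub_sq_real, norm_smul, norm_smul, mul_pow, mul_pow,
    Real.norm_eq_abs, Real.norm_eq_abs, sq_abs, sq_abs, real_inner_smul_left,
    real_inner_smul_right]
  ring

/-- A semiconcave function is touched from above at every point by a paraboloid. -/
theorem Semiconcave.exists_eventually_le {n : ℕ} {U : Set (EuclideanSpace ℝ (Fin n))}
    (hU : IsOpen U) {u : EuclideanSpace ℝ (Fin n) → ℝ} (hu : Semiconcave U u)
    {x₀ : EuclideanSpace ℝ (Fin n)} (hx₀ : x₀ ∈ U) :
    ∃ (l : EuclideanSpace ℝ (Fin n) →L[ℝ] ℝ) (C : ℝ),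
      ∀ᶠ x in 𝓝 x₀, u x ≤ u x₀ + l (x - x₀) + C * ‖x - x₀‖ ^ 2 := by
  obtain ⟨r, hr, hrU⟩ := nhds_basis_closedBall.mem_iff.1 (hU.mem_nhds hx₀)
  obtain ⟨C, -, hC⟩ := hu _ hrU (isCompact_closedBall x₀ r) (convex_closedBall x₀ r)
  have hconv : ConvexOn ℝ (ball x₀ r) fun x => C * ‖x - x₀‖ ^ 2 - u x := by
    refine ⟨convex_ball x₀ r, fun x hx y hy a b ha hb hab => ?_⟩
    obtain rfl : b = 1 - a := by linarith
    have h := hC a ⟨ha, by linarith⟩ y (ball_subset_closedBall hy) x (ball_subset_closedBall hx)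
    have hcomb : a • x + (1 - a) • y - x₀ = a • (x - x₀) + (1 - a) • (y - x₀) := by module
    have hsq := norm_sq_convexCombination a (x - x₀) (y - x₀)
    rw [sub_sub_sub_cancel_right] at hsq
    simp only [smul_eq_mul]
    rw [hcomb, hsq]
    linarith
  obtain ⟨l, hl⟩ := hconv.exists_subgradient isOpen_ball (mem_ball_self hr)
  refine ⟨-l, C, ?_⟩
  filter_upwards [ball_mem_nhds x₀ hr] with x hx
  have h := hl x hx
  simp only [sub_self, norm_zero, neg_apply] at h ⊢
  linarith

theorem hasFDerivAt_of_eventually_abs_le {E : Type*} [NormedAddCommGroup E] [NormedSpace ℝ E]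
    {u : E → ℝ} {l : E →L[ℝ] ℝ} {x₀ : E} {C : ℝ}
    (h : ∀ᶠ x in 𝓝 x₀, |u x - u x₀ - l (x - x₀)| ≤ C * ‖x - x₀‖ ^ 2) :
    HasFDerivAt u l x₀ := by
  have hO : (fun x => u x - u x₀ - l (x - x₀)) =O[𝓝 x₀] fun x => ‖x - x₀‖ ^ 2 :=
    .of_bound C (by simpa using h)
  simpa using ((hO.hasFDerivAt one_lt_two).add (l.hasFDerivAt.sub_const (l x₀))).add_const (u x₀)

/-- If two semiconcave functions `f, g` on an open `U` are such that `f + g` attains a local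
minimum at `x₀ ∈ U`, then both are differentiable at `x₀` and `Df(x₀) + Dg(x₀) = 0`. -/
theorem stmt_13 (n : ℕ) (U : Set (EuclideanSpace ℝ (Fin n))) (hU : IsOpen U)
    (f g : EuclideanSpace ℝ (Fin n) → ℝ)
    (hf : Semiconcave U f) (hg : Semiconcave U g)
    (x₀ : EuclideanSpace ℝ (Fin n)) (hx₀ : x₀ ∈ U)
    (hmin : IsLocalMinOn (fun x => f x + g x) U x₀) :
    DifferentiableAt ℝ f x₀ ∧ DifferentiableAt ℝ g x₀ ∧
      gradient f x₀ + gradient g x₀ = 0 := by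
  have hmin' : IsLocalMin (fun x => f x + g x) x₀ := hmin.isLocalMin (hU.mem_nhds hx₀)
  obtain ⟨l, C, hl⟩ := hf.exists_eventually_le hU hx₀
  obtain ⟨m, D, hm⟩ := hg.exists_eventually_le hU hx₀
  have hlm : l + m = 0 := by
    have hloc : IsLocalMin (fun x => (l + m) (x - x₀) + (C + D) * ‖x - x₀‖ ^ 2) x₀ := by
      filter_upwards [hl, hm, hmin'] with x hlx hmx hx
      simp only [sub_self, map_zero, norm_zero, add_apply]
      linarith
    refine hloc.hasFDerivAt_eq_zero (hasFDerivAt_of_eventually_abs_le (C := |C + D|) ?_)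
    simp [abs_mul]
  have hml : m = -l := (neg_eq_of_add_eq_zero_right hlm).symm
  have hf' : HasFDerivAt f l x₀ := by
    refine hasFDerivAt_of_eventually_abs_le (C := max C D) ?_
    filter_upwards [hl, hm, hmin'] with x hlx hmx hx
    have hC := mul_le_mul_of_nonneg_right (le_max_left C D) (sq_nonneg ‖x - x₀‖)
    have hD := mul_le_mul_of_nonneg_right (le_max_right C D) (sq_nonneg ‖x - x₀‖)
    rw [hml, neg_apply] at hmx
    rw [abs_le]
    constructor <;> linarith
  have hg' : HasFDerivAt g m x₀ := by
    refine hasFDerivAt_of_eventually_abs_le (C := max C D) ?_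
    filter_upwards [hl, hm, hmin'] with x hlx hmx hx
    have hC := mul_le_mul_of_nonneg_right (le_max_left C D) (sq_nonneg ‖x - x₀‖)
    have hD := mul_le_mul_of_nonneg_right (le_max_right C D) (sq_nonneg ‖x - x₀‖)
    rw [hml, neg_apply] at hmx ⊢
    rw [abs_le]
    constructor <;> linarith
  refine ⟨hf'.differentiableAt, hg'.differentiableAt, ?_⟩
  rw [gradient, gradient, hf'.fderiv, hg'.fderiv, ← map_add, hlm, map_zero]
end
end
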